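/- arXiv:2108.03664 — 2 statements merged into one kernel-verified Lean document; each statement's English description precedes it below -/
import Mathlib

section
/- Let b ≥ 2 be an integer with b ∈ Γ. Then the set T_b of Trott numbers in base b is not an F_σ subset of the real line, i.e., T_b cannot be written as a countable union of closed sets. -/
open Filter Topology

/-- Number of digits of `a` in base `b`. -/
def digLen (b a : ℕ) : ℕ := (Nat.digits b a).length

/-- Value of the finite continued fraction `[0; a₁, a₂, …, aₙ]`. -/
noncomputable def cfVal : List ℕ → ℝ
  | [] => 0
  | (h :: t) => 1 / ((h : ℝ) + cfVal t)

/-- `a` witnesses that `x` is a Trott number in base `b`: the `a i` (indexed from 0)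
are positive, `x` is the value of the infinite continued fraction `[0; a 0, a 1, …]`,
and the base-`b` expansion of `x` is the concatenation of the base-`b` digit strings
of the partial quotients. -/
def IsTrottWith (b : ℕ) (x : ℝ) (a : ℕ → ℕ) : Prop :=
  (∀ i, 0 < a i) ∧
  Tendsto (fun n => cfVal ((List.range n).map a)) atTop (𝓝 x) ∧
  x = ∑' i : ℕ, (a i : ℝ) / (b : ℝ) ^ (∑ j ∈ Finset.range (i + 1), digLen b (a j))

/-- `x` is a Trott number in base `b`. -/
def IsTrott (b : ℕ) (x : ℝ) : Prop := ∃ a, IsTrottWith b x a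

/-- The set of Trott numbers in base `b`. -/
def TrottSet (b : ℕ) : Set ℝ := {x | IsTrott b x}

/-- The set `Γ = {3} ∪ ⋃_{k≥1} {k²+1, …, k²+k}`. -/
def Gamma : Set ℕ := {b | b = 3 ∨ ∃ k : ℕ, 1 ≤ k ∧ k ^ 2 + 1 ≤ b ∧ b ≤ k ^ 2 + k}

/-- `x` divides a power of `b`. -/
def DvdPow (b : ℕ) (x : ℤ) : Prop := ∃ M : ℕ, x ∣ (b : ℤ) ^ M

theorem digLen_eq {b a m : ℕ} (hb : 2 ≤ b) (h₁ : b ^ m ≤ a) (h₂ : a < b ^ (m + 1)) :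
    digLen b a = m + 1 := by
  have ha : a ≠ 0 := by
    have : 0 < b ^ m := by positivity
    omega
  unfold digLen
  rw [Nat.length_digits b a (by omega) ha, Nat.log_eq_of_pow_le_of_lt_pow h₁ h₂]

theorem lt_base_pow_digLen {b : ℕ} (hb : 2 ≤ b) (a : ℕ) : a < b ^ digLen b a :=
  Nat.lt_base_pow_length_digits hb

theorem digLen_pos {b a : ℕ} (hb : 2 ≤ b) (ha : 0 < a) : 0 < digLen b a := by
  by_contra h
  have := lt_base_pow_digLen hb a
  simp [Nat.eq_zero_of_not_pos h] at this
  omega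

/-- A divisor of a power of `b` that divides `α b ^ m + β` with `m ≥ |β|` divides `β`. -/
theorem DvdPow.dvd_of_dvd_add {b m : ℕ} {x α β : ℤ} (hβ : β ≠ 0)
    (hm : β.natAbs ≤ m) (hx : x ∣ α * (b : ℤ) ^ m + β) (hs : DvdPow b x) : x ∣ β := by
  obtain ⟨M, hM⟩ := hs
  rw [← Int.natAbs_dvd_natAbs, Nat.dvd_iff_prime_pow_dvd_dvd]
  intro p k hp hpk
  rcases Nat.eq_zero_or_pos k with rfl | hk
  · simp
  have hpx : (p : ℤ) ^ k ∣ x := by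
    rw [← Int.dvd_natAbs]; exact_mod_cast hpk
  have hpb : (p : ℤ) ∣ b :=
    (Nat.prime_iff_prime_int.mp hp).dvd_of_dvd_pow
      (((dvd_pow_self (p : ℤ) hk.ne').trans hpx).trans hM)
  have key : ∀ l, l ≤ k → l ≤ m → (p : ℤ) ^ l ∣ β := by
    intro l hlk hlm
    have h1 : (p : ℤ) ^ l ∣ α * (b : ℤ) ^ m + β := ((pow_dvd_pow _ hlk).trans hpx).trans hx
    have h2 : (p : ℤ) ^ l ∣ α * (b : ℤ) ^ m :=
      ((pow_dvd_pow_of_dvd hpb l).trans (pow_dvd_pow _ hlm)).mul_left _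
    exact (dvd_add_right h2).mp h1
  rcases le_or_gt k m with h | h
  · have := key k le_rfl h
    rw [← Int.dvd_natAbs] at this
    exact_mod_cast this
  · exfalso
    have := key m h.le le_rfl
    rw [← Int.dvd_natAbs] at this
    have h3 : p ^ m ∣ β.natAbs := by exact_mod_cast this
    have h4 := Nat.le_of_dvd (Int.natAbs_pos.mpr hβ) h3
    have h5 := Nat.lt_pow_self (n := m) hp.one_lt
    omega

/-- If `v` divides no `b ^ j * u`, the base-`b` expansion of `u / v` has nonzero digits
arbitrarily far out. -/
theorem exists_emod_ge {b : ℕ} (hb : 2 ≤ b) {u v : ℤ} (hv : 0 < v)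
    (h : ∀ j : ℕ, ¬ v ∣ (b : ℤ) ^ j * u) (M : ℕ) :
    ∃ j, M ≤ j ∧ v ≤ b * ((b : ℤ) ^ j * u % v) := by
  by_contra! hc
  have hb' : (2 : ℤ) ≤ b := by exact_mod_cast hb
  have key : ∀ i : ℕ, (b : ℤ) ^ i ≤ (b : ℤ) ^ (M + i) * u % v := by
    intro i
    induction i with
    | zero =>
      have h1 := Int.emod_nonneg ((b : ℤ) ^ M * u) hv.ne'
      have h2 : (b : ℤ) ^ M * u % v ≠ 0 := fun h0 => h M (Int.dvd_of_emod_eq_zero h0)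
      simp only [pow_zero, add_zero]
      omega
    | succ i ih =>
      have h1 := hc (M + i) (by omega)
      have h2 := Int.emod_nonneg ((b : ℤ) ^ (M + i) * u) hv.ne'
      have h3 : (b : ℤ) ^ (M + (i + 1)) * u % v = b * ((b : ℤ) ^ (M + i) * u % v) := by
        rw [← Int.emod_eq_of_lt (mul_nonneg (by omega) h2) h1]
        refine Eq.trans ?_ (Int.ModEq.mul_left (b : ℤ) (Int.mod_modEq _ v)).symm
        congr 1; ring
      rw [h3, pow_succ']
      exact mul_le_mul_of_nonneg_left ih (by omega)
  have h1 := key v.toNat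
  have h2 := Int.emod_lt_of_pos ((b : ℤ) ^ (M + v.toNat) * u) hv
  have h3 : v.toNat < b ^ v.toNat := Nat.lt_pow_self (by omega)
  have h4 : (v.toNat : ℤ) < (b : ℤ) ^ v.toNat := by exact_mod_cast h3
  omega

theorem exists_emod_mem {b : ℕ} (hb : 2 ≤ b) {u v : ℤ} (hv : 0 < v)
    (h : ∀ j : ℕ, ¬ v ∣ (b : ℤ) ^ j * u) (M : ℕ) :
    ∃ j, M ≤ j ∧ v ≤ b * ((b : ℤ) ^ j * u % v) ∧
      v ≤ b ^ 2 * (v - (b : ℤ) ^ j * u % v) := by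
  by_contra! hc
  have hb' : (2 : ℤ) ≤ b := by exact_mod_cast hb
  obtain ⟨j, hj, hj1⟩ := exists_emod_ge hb hv h M
  have key : ∀ i : ℕ, v ≤ b * ((b : ℤ) ^ (j + i) * u % v) ∧
      (b : ℤ) ^ i ≤ v - (b : ℤ) ^ (j + i) * u % v := by
    intro i
    induction i with
    | zero =>
      have h1 := Int.emod_lt_of_pos ((b : ℤ) ^ j * u) hv
      simp only [pow_zero, add_zero]
      exact ⟨hj1, by omega⟩
    | succ i ih =>
      obtain ⟨ih1, ih2⟩ := ih
      have h1 := hc (j + i) (by omega) ih1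
      set y := (b : ℤ) ^ (j + i) * u % v with hy
      have hyv : y < v := Int.emod_lt_of_pos _ hv
      have h0 : (b : ℤ) * (v - y) < v := by nlinarith
      have h3 : (b : ℤ) ^ (j + (i + 1)) * u % v = v - b * (v - y) := by
        have e1 : (v - b * (v - y)) % v = v - b * (v - y) :=
          Int.emod_eq_of_lt (by omega) (by nlinarith)
        rw [← e1]
        have e2 : v - b * (v - y) = b * y + v * (1 - b) := by ring
        rw [e2, Int.add_mul_emod_self_left, hy]
        refine Eq.trans ?_ (Int.ModEq.mul_left (b : ℤ) (Int.mod_modEq _ v)).symm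
        congr 1; ring
      rw [h3, pow_succ']
      constructor
      · nlinarith
      · have := mul_le_mul_of_nonneg_left ih2 (by omega : (0 : ℤ) ≤ b)
        linarith
  have h1 := (key v.toNat).2
  have h2 := Int.emod_nonneg ((b : ℤ) ^ (j + v.toNat) * u) hv.ne'
  have h3 : v.toNat < b ^ v.toNat := Nat.lt_pow_self (by omega)
  have h4 : (v.toNat : ℤ) < (b : ℤ) ^ v.toNat := by exact_mod_cast h3
  omega

/-- Two quantities affine in `b ^ m` with nonzero constant terms are large and divide no power
of `b` once `m` is large. -/
theorem affine_large {b m : ℕ} (hb : 2 ≤ b) {c α γ β₁ β₂ C Q R : ℤ} (hc : 1 ≤ c) (hα : 1 ≤ α)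
    (hγ : 1 ≤ γ) (hβ₁ : β₁ ≠ 0) (hβ₂ : β₂ ≠ 0) (hC : 0 ≤ C)
    (hQ : Q = α * (b : ℤ) ^ m + β₁) (hR : c * R = γ * (b : ℤ) ^ m + β₂)
    (hm : 2 * |β₁| + 2 * (c + 1) * |β₂| + 4 * c * C ≤ m) :
    C * (b : ℤ) ^ m < Q * R ∧ ¬ DvdPow b Q ∧ ¬ DvdPow b R := by
  have hBm : (m : ℤ) < (b : ℤ) ^ m := by exact_mod_cast Nat.lt_pow_self (n := m) (by omega : 1 < b)
  set B := (b : ℤ) ^ m with hB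
  have a1 := abs_nonneg β₁
  have a2 := abs_nonneg β₂
  have n1 := neg_abs_le β₁
  have n2 := neg_abs_le β₂
  have cC : 0 ≤ c * C := mul_nonneg (by omega) hC
  have cb : 0 ≤ c * |β₂| := mul_nonneg (by omega) a2
  have hB0 : 0 < B := by linarith [Int.natCast_nonneg m]
  have hQB : B - |β₁| ≤ Q := by nlinarith
  have hRB : B - |β₂| ≤ c * R := by nlinarith
  have hR2 : |β₂| < R := by
    by_contra! h
    nlinarith [mul_le_mul_of_nonneg_left h (by omega : 0 ≤ c)]
  refine ⟨?_, fun h => ?_, fun h => ?_⟩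
  · have h1 : B ≤ 2 * Q := by nlinarith
    have h2 : B ≤ 2 * (c * R) := by nlinarith
    have h3 : B * B ≤ (2 * Q) * (2 * (c * R)) := mul_le_mul h1 h2 hB0.le (by linarith)
    have h4 : 4 * c * C < B := by nlinarith
    have h5 : 4 * c * C * B < B * B := mul_lt_mul_of_pos_right h4 hB0
    have h6 : (4 * c) * (C * B) < (4 * c) * (Q * R) := by nlinarith
    exact lt_of_mul_lt_mul_left h6 (by omega)
  · have hm1 : β₁.natAbs ≤ m := by
      zify; nlinarith
    have := Int.le_of_dvd (abs_pos.mpr hβ₁) ((dvd_abs _ _).mpr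
      (h.dvd_of_dvd_add hβ₁ hm1 (α := α) (by rw [hQ])))
    nlinarith
  · have hm1 : β₂.natAbs ≤ m := by
      zify; nlinarith
    have := Int.le_of_dvd (abs_pos.mpr hβ₂) ((dvd_abs _ _).mpr
      (h.dvd_of_dvd_add hβ₂ hm1 (α := γ) (by rw [← hB, ← hR]; exact dvd_mul_left _ _)))
    linarith

theorem exists_frequently_emod_eq {b : ℕ} (hb : 2 ≤ b) {q r : ℤ} (hq : 0 < q)
    (h : ∀ j : ℕ, ¬ q ∣ (b : ℤ) ^ j * r) :
    ∃ ρ : ℤ, q ≤ b * ρ ∧ q ≤ b ^ 2 * (q - ρ) ∧ ∃ᶠ m : ℕ in atTop, (b : ℤ) ^ m * r % q = ρ := by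
  obtain ⟨ρ, -, hρ⟩ : ∃ ρ ∈ Finset.Ico 0 q, ∃ᶠ m : ℕ in atTop,
      ((b : ℤ) ^ m * r % q = ρ ∧ q ≤ b * ρ ∧ q ≤ b ^ 2 * (q - ρ)) := by
    rw [← Finset.frequently_exists, frequently_atTop]
    intro M
    obtain ⟨j, hj, h1, h2⟩ := exists_emod_mem hb hq h M
    exact ⟨j, hj, _, Finset.mem_Ico.mpr ⟨Int.emod_nonneg _ hq.ne', Int.emod_lt_of_pos _ hq⟩,
      rfl, h1, h2⟩
  obtain ⟨m, -, hρ1, hρ2⟩ := hρ.exists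
  exact ⟨ρ, hρ1, hρ2, hρ.mono fun _ hm => hm.1⟩

/-- Arbitrarily long initial digit strings `c` of `u / v ∈ [1 / b, 1)` such that the fractional
part `w / v` left over exceeds `1 / b`. -/
theorem exists_digit_prefix {b : ℕ} (hb : 2 ≤ b) {u v : ℤ} (hv : 0 < v) (huv : u < v)
    (hvu : v ≤ b * u) (h : ∀ j : ℕ, ¬ v ∣ (b : ℤ) ^ j * u) (M : ℕ) :
    ∃ (i c : ℕ) (w : ℤ), M ≤ i ∧ (b : ℤ) ^ (i + 1) * u = v * c + w ∧ w < v ∧ v < b * w ∧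
      (b : ℤ) ^ i ≤ c ∧ digLen b c = i + 1 := by
  have hb' : (2 : ℤ) ≤ b := by exact_mod_cast hb
  obtain ⟨j, hj, hw⟩ := exists_emod_ge hb hv h (M + 1)
  obtain ⟨i, rfl⟩ : ∃ i, j = i + 1 := ⟨j - 1, by omega⟩
  have hpos : 0 < (b : ℤ) ^ i := by positivity
  have hpos' : 0 < (b : ℤ) ^ (i + 1) := by positivity
  have hdiv := Int.mul_ediv_add_emod ((b : ℤ) ^ (i + 1) * u) v
  obtain ⟨c, hc⟩ : ∃ c : ℕ, (c : ℤ) = (b : ℤ) ^ (i + 1) * u / v :=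
    ⟨_, Int.toNat_of_nonneg (Int.ediv_nonneg (by nlinarith) hv.le)⟩
  have hclow : (b : ℤ) ^ i ≤ c := by
    rw [hc, Int.le_ediv_iff_mul_le hv, pow_succ]
    nlinarith
  have hcup : (c : ℤ) < (b : ℤ) ^ (i + 1) := by
    rw [hc]
    exact Int.ediv_lt_of_lt_mul hv (by nlinarith)
  refine ⟨i, c, (b : ℤ) ^ (i + 1) * u % v, by omega, by rw [hc, hdiv], Int.emod_lt_of_pos _ hv,
    lt_of_le_of_ne hw fun he => h (i + 2) ?_, hclow,
    digLen_eq hb (by exact_mod_cast hclow) (by exact_mod_cast hcup)⟩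
  refine ⟨b * ((b : ℤ) ^ (i + 1) * u / v) + 1, ?_⟩
  rw [pow_succ]
  linear_combination -(b : ℤ) * hdiv - he

theorem exists_quotient {b : ℕ} (hb : 2 ≤ b) {q r ρ : ℤ} {m : ℕ} (hq : 0 < q)
    (hlow : q < b * r) (hup : (b : ℤ) ^ m * b * r - ρ < (b : ℤ) ^ m * b * q) (hm : ρ ≤ m)
    (hmod : q ∣ (b : ℤ) ^ (m + 1) * r - ρ) :
    ∃ a : ℕ, (b : ℤ) ^ (m + 1) * r = a * q + ρ ∧ digLen b a = m + 1 := by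
  have hb' : (2 : ℤ) ≤ b := by exact_mod_cast hb
  have hpos : 0 < (b : ℤ) ^ m := by positivity
  have hlt : (m : ℤ) < (b : ℤ) ^ m := by exact_mod_cast Nat.lt_pow_self (n := m) (by omega : 1 < b)
  obtain ⟨z, hz⟩ := hmod
  rw [pow_succ] at hz
  have h1 : (b : ℤ) ^ m ≤ z := by
    have : q * (b : ℤ) ^ m ≤ q * z := by nlinarith
    exact le_of_mul_le_mul_left this hq
  have h2 : z < (b : ℤ) ^ (m + 1) := by
    have : q * z < q * (b : ℤ) ^ (m + 1) := by rw [pow_succ]; linarith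
    exact lt_of_mul_lt_mul_left this hq.le
  lift z to ℕ using by linarith
  exact ⟨z, by rw [pow_succ]; linarith, digLen_eq hb (by exact_mod_cast h1) (by exact_mod_cast h2)⟩

/-- Data attached to a finite string of partial quotients `a₁, …, aₙ`: the last two convergents
`p / q` and `p' / q'`, the integer `N` whose base-`b` digits are the concatenation of those of the
`aᵢ`, and the total number `s` of digits. -/
structure ConvState where
  p : ℤ
  p' : ℤ
  q : ℤ
  q' : ℤ
  N : ℤ
  s : ℕ

namespace ConvState

/-- The data of the empty string. -/
def empty : ConvState := ⟨0, 1, 1, 0, 0, 0⟩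

/-- The data after appending the partial quotient `a`. -/
def push (b : ℕ) (S : ConvState) (a : ℕ) : ConvState :=
  ⟨a * S.p + S.p', S.p, a * S.q + S.q', S.q, S.N * (b : ℤ) ^ digLen b a + a, S.s + digLen b a⟩

/-- `q` times the difference `b ^ s * p / q - N`. -/
def rem (b : ℕ) (S : ConvState) : ℤ := (b : ℤ) ^ S.s * S.p - S.N * S.q

/-- `q'` times the difference `b ^ s * p' / q' - N`. -/
def rem' (b : ℕ) (S : ConvState) : ℤ := (b : ℤ) ^ S.s * S.p' - S.N * S.q'

theorem rem_push (b : ℕ) (S : ConvState) (a : ℕ) :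
    (S.push b a).rem b =
      (b : ℤ) ^ digLen b a * (a * S.rem b + S.rem' b) - a * (a * S.q + S.q') := by
  simp only [push, rem, rem']; ring

theorem rem'_push (b : ℕ) (S : ConvState) (a : ℕ) :
    (S.push b a).rem' b = (b : ℤ) ^ digLen b a * S.rem b - a * S.q := by
  simp only [push, rem, rem']; ring

/-- States from which the construction can be continued: the digits of `p / q` begin with those
of the partial quotients followed by a nonzero digit, `q ^ 2` is large compared with `b ^ s`, and
neither `q` nor the remainder divides a power of `b`. -/
structure Good (b : ℕ) (S : ConvState) : Prop where
  det : S.q * S.p' - S.q' * S.p = 1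
  q_pos : 0 < S.q
  lower : S.q < b * S.rem b
  upper : S.rem b < S.q
  large : (b : ℤ) ^ 2 * (b : ℤ) ^ S.s < S.q * S.rem b
  q_not : ¬ DvdPow b S.q
  rem_not : ¬ DvdPow b (S.rem b)

theorem det_push_push (b : ℕ) (S : ConvState) (a c : ℕ) :
    ((S.push b a).push b c).q * ((S.push b a).push b c).p' -
      ((S.push b a).push b c).q' * ((S.push b a).push b c).p = S.q * S.p' - S.q' * S.p := by
  simp only [push]; ring

theorem Good.rem_pos {b : ℕ} {S : ConvState} (h : S.Good b) : 0 < S.rem b := by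
  have h1 := h.lower
  have h2 := h.q_pos
  by_contra! h0
  nlinarith

/-- The limiting shape of the next two steps out of a good state: `ρ / q` is a recurring tail of
the digits of `p / q`, and `c` is a long string of leading digits of the limiting remainder
`(ρ * r + b ^ s) / (q * r)`, leaving the fractional part `w / (q * r)`. -/
theorem Good.exists_limit {b : ℕ} (hb : 2 ≤ b) {S : ConvState} (h : S.Good b) :
    ∃ (ρ w : ℤ) (i c : ℕ), 0 < ρ ∧ (∃ᶠ m : ℕ in atTop, (b : ℤ) ^ m * S.rem b % S.q = ρ) ∧
      (b : ℤ) ^ (i + 1) * (ρ * S.rem b + (b : ℤ) ^ S.s) = S.q * S.rem b * c + w ∧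
      w < S.q * S.rem b ∧ S.q * S.rem b < b * w ∧ digLen b c = i + 1 ∧ S.q < c ∧
      S.q * S.rem b < (b : ℤ) ^ (i + 1) := by
  have hb' : (2 : ℤ) ≤ b := by exact_mod_cast hb
  have hr := h.rem_pos
  obtain ⟨hdet, hq, hlow, hup, hlarge, hqn, hrn⟩ := h
  have hdet' : S.q * S.rem' b - S.q' * S.rem b = (b : ℤ) ^ S.s := by
    simp only [rem, rem']; linear_combination (b : ℤ) ^ S.s * hdet
  have hD : 0 < (b : ℤ) ^ S.s := by positivity
  generalize hDD : (b : ℤ) ^ S.s = D at hdet' hlarge hD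
  generalize S.rem b = r at *
  generalize S.rem' b = r' at *
  have hnd : ∀ j : ℕ, ¬ S.q ∣ (b : ℤ) ^ j * r := by
    rintro j hj
    refine hqn ⟨j + S.s, ?_⟩
    have : (b : ℤ) ^ (j + S.s) = S.q * ((b : ℤ) ^ j * r') - S.q' * ((b : ℤ) ^ j * r) := by
      rw [pow_add, hDD, ← hdet']; ring
    rw [this]
    exact dvd_sub (dvd_mul_right _ _) (hj.mul_left _)
  obtain ⟨ρ, hρ1, hρ2, hρ⟩ := exists_frequently_emod_eq hb hq hnd
  have hρ0 : 0 < ρ := by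
    by_contra! h0
    nlinarith
  have huv : ρ * r + D < S.q * r := by
    have h1 : (b : ℤ) ^ 2 * D < b ^ 2 * ((S.q - ρ) * r) := by nlinarith
    linarith [lt_of_mul_lt_mul_left h1 (by positivity)]
  have hvu : S.q * r ≤ b * (ρ * r + D) := by nlinarith
  have hndv : ∀ j : ℕ, ¬ S.q * r ∣ (b : ℤ) ^ j * (ρ * r + D) := by
    rintro j hj
    refine hrn ⟨j + S.s, ?_⟩
    have h1 : r ∣ (b : ℤ) ^ j * (ρ * r + D) := (dvd_mul_left r S.q).trans hj
    have : (b : ℤ) ^ (j + S.s) = (b : ℤ) ^ j * (ρ * r + D) - (b : ℤ) ^ j * ρ * r := by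
      rw [pow_add, hDD]; ring
    rw [this]
    exact dvd_sub h1 (dvd_mul_left _ _)
  obtain ⟨i, c, w, hi, hcw, hwv, hw, hclow, hclen⟩ :=
    exists_digit_prefix hb (mul_pos hq hr) huv hvu hndv ((S.q * r).toNat + S.q.toNat)
  have hbi : (i : ℤ) < (b : ℤ) ^ i := by exact_mod_cast Nat.lt_pow_self (n := i) (by omega : 1 < b)
  have hGi : (b : ℤ) ^ i ≤ (b : ℤ) ^ (i + 1) := pow_le_pow_right₀ (by omega) (by omega)
  have hcq : S.q < c := by omega
  have hvG : S.q * r < (b : ℤ) ^ (i + 1) := by omega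
  exact ⟨ρ, w, i, c, hρ0, hρ, hcw, hwv, hw, hclen, hcq, hvG⟩

/-- The denominator and remainder after two steps, as affine functions of `b ^ digLen b a`. -/
theorem push_push_eq {b : ℕ} {S : ConvState} {a c : ℕ} {ρ w D : ℤ}
    (hdet : S.q * S.rem' b - S.q' * S.rem b = D)
    (ha : (b : ℤ) ^ digLen b a * S.rem b = a * S.q + ρ)
    (hc : (b : ℤ) ^ digLen b c * (ρ * S.rem b + D) = S.q * S.rem b * c + w) :
    ((S.push b a).push b c).q =
        c * S.rem b * (b : ℤ) ^ digLen b a + (S.q - c * (ρ - S.q')) ∧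
      S.q * ((S.push b a).push b c).rem b = c * w * (b : ℤ) ^ digLen b a +
        (S.q - c * (ρ - S.q')) * ((b : ℤ) ^ digLen b c * ρ - c * S.q) := by
  have h1 : S.q * (S.push b a).rem b =
      (b : ℤ) ^ digLen b a * (ρ * S.rem b + D) - (ρ - S.q') * ρ := by
    rw [rem_push]
    linear_combination (b : ℤ) ^ digLen b a * hdet + (S.q' + a * S.q - ρ) * ha
  have h2 : (S.push b a).rem' b = ρ := by
    rw [rem'_push]
    linear_combination ha
  have h3 : (S.push b a).q = a * S.q + S.q' := rfl
  have h4 : (S.push b a).q' = S.q := rfl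
  have h5 : ((S.push b a).push b c).q = c * (a * S.q + S.q') + S.q := rfl
  refine ⟨by rw [h5]; linear_combination -c * ha, ?_⟩
  rw [rem_push, h2, h3, h4]
  linear_combination (b : ℤ) ^ digLen b c * c * h1 + c * (b : ℤ) ^ digLen b a * hc
    + c ^ 2 * S.q * ha

set_option maxHeartbeats 400000 in
theorem Good.exists_push {b : ℕ} (hb : 2 ≤ b) {S : ConvState} (h : S.Good b) (K : ℕ) :
    ∃ a c : ℕ, K ≤ a ∧ 0 < a ∧ 0 < c ∧ ((S.push b a).push b c).Good b := by
  have hb' : (2 : ℤ) ≤ b := by exact_mod_cast hb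
  have hr := h.rem_pos
  obtain ⟨ρ, w, i, c, hρ0, hρ, hcw, hwv, hw, hclen, hcq, hvG⟩ := h.exists_limit hb
  obtain ⟨hdet, hq, hlow, hup, hlarge, hqn, hrn⟩ := h
  clear hlarge hqn hrn
  have hdet' : S.q * S.rem' b - S.q' * S.rem b = (b : ℤ) ^ S.s := by
    simp only [rem, rem']; linear_combination (b : ℤ) ^ S.s * hdet
  have hD : 0 < (b : ℤ) ^ S.s := by positivity
  generalize hDD : (b : ℤ) ^ S.s = D at *
  generalize hrr : S.rem b = r at *
  generalize hrr' : S.rem' b = r' at *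
  have hw1 : 1 ≤ w := by
    by_contra! h0
    nlinarith
  generalize hGG : (b : ℤ) ^ (i + 1) = G at *
  obtain ⟨β₁, hβ₁⟩ : ∃ β₁, β₁ = S.q - c * (ρ - S.q') := ⟨_, rfl⟩
  obtain ⟨β₂, hβ₂⟩ : ∃ β₂, β₂ = β₁ * (G * ρ - c * S.q) := ⟨_, rfl⟩
  have hβ₁0 : β₁ ≠ 0 := by
    intro h0
    have h1 : S.q = c * (ρ - S.q') := by linarith
    have h2 : 0 < ρ - S.q' := pos_of_mul_pos_right (h1 ▸ hq) (by omega)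
    have h3 := le_mul_of_one_le_right (by omega : (0 : ℤ) ≤ c) h2
    omega
  have hβ₂0 : β₂ ≠ 0 := by
    rw [hβ₂]
    refine mul_ne_zero hβ₁0 fun h0 => ?_
    have h1 : w = G * D := by linear_combination -hcw + r * h0
    have h2 := le_mul_of_one_le_right (by linarith [mul_pos hq hr] : 0 ≤ G) hD
    linarith
  have hC0 : 0 ≤ (b : ℤ) ^ 2 * D * G := by
    have : 0 < G := by linarith [mul_pos hq hr]
    positivity
  obtain ⟨M, hM⟩ : ∃ M : ℕ, 2 * |β₁| + 2 * (S.q + 1) * |β₂| + 4 * S.q * ((b : ℤ) ^ 2 * D * G)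
      + S.q * |β₁| + b * |β₂| + ρ + K * S.q + S.q + 1 ≤ M := ⟨_, Int.self_le_toNat _⟩
  obtain ⟨m, hmM, hmρ⟩ := frequently_atTop.mp hρ M
  have habs₁ : 0 ≤ S.q * |β₁| := by positivity
  have habs₂ : 0 ≤ b * |β₂| := by positivity
  have habs₃ : 0 ≤ (S.q + 1) * |β₂| := by positivity
  have habs₄ : 0 ≤ K * S.q := by positivity
  have habs₅ : 0 ≤ S.q * ((b : ℤ) ^ 2 * D * G) := mul_nonneg hq.le hC0
  have habs₆ := abs_nonneg β₁
  have hmM' : (M : ℤ) ≤ m := by exact_mod_cast hmM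
  have hM1 : (1 : ℤ) ≤ M := by linarith
  obtain ⟨n, rfl⟩ : ∃ n, m = n + 1 := ⟨m - 1, by omega⟩
  have hBm : ((n + 1 : ℕ) : ℤ) < (b : ℤ) ^ (n + 1) := by
    exact_mod_cast Nat.lt_pow_self (n := n + 1) (by omega : 1 < b)
  obtain ⟨a, ha, halen⟩ := exists_quotient hb (m := n) (ρ := ρ) hq hlow
    (by linarith [mul_le_mul_of_nonneg_left hup.le (by positivity : 0 ≤ (b : ℤ) ^ n * b)])
    (by push_cast at hmM'; linarith)
    (by rw [← hmρ]; exact Int.dvd_self_sub_emod)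
  have hKa : (K : ℤ) < a := by
    have : (K : ℤ) * S.q < a * S.q := by
      linarith [le_mul_of_one_le_right (by positivity : 0 ≤ (b : ℤ) ^ (n + 1)) hr]
    exact lt_of_mul_lt_mul_right this hq.le
  obtain ⟨hQ, hR⟩ := push_push_eq (b := b) (S := S) (a := a) (c := c) (ρ := ρ) (w := w) (D := D)
    (by rw [hrr, hrr', hdet']) (by rw [hrr, halen, ha]) (by rw [hrr, hclen, hGG, hcw])
  rw [← hβ₁, halen, hrr] at hQ
  rw [hclen, hGG, ← hβ₁, ← hβ₂, halen] at hR
  have hS : ((S.push b a).push b c).s = S.s + (n + 1) + (i + 1) := by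
    simp only [push, halen, hclen]
  have hc0 : (0 : ℤ) < c := by linarith
  have hcr : 1 ≤ c * r := mul_pos hc0 hr
  have hcw1 : 1 ≤ c * w := mul_pos hc0 hw1
  obtain ⟨hl1, hl2, hl3⟩ := affine_large hb (by omega : 1 ≤ S.q)
    hcr hcw1 hβ₁0 hβ₂0 hC0 hQ hR
    (by linarith)
  have hqa : S.q * |β₁| + b * |β₂| < (b : ℤ) ^ (n + 1) := by linarith
  have n₁ := mul_le_mul_of_nonneg_left (neg_abs_le β₁) hq.le
  have n₁' := mul_le_mul_of_nonneg_left (le_abs_self β₁) hq.le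
  have n₂ := mul_le_mul_of_nonneg_left (neg_abs_le β₂) (by omega : (0 : ℤ) ≤ b)
  have n₂' := mul_le_mul_of_nonneg_right (by omega : (1 : ℤ) ≤ b) (abs_nonneg β₂)
  have n₃ := le_abs_self β₂
  refine ⟨a, c, by omega, by omega, by omega, (det_push_push b S a c).trans hdet, ?_, ?_, ?_, ?_,
    hl2, hl3⟩
  · rw [hQ]
    have : (1 : ℤ) * (b : ℤ) ^ (n + 1) ≤ c * r * (b : ℤ) ^ (n + 1) :=
      mul_le_mul_of_nonneg_right hcr (by positivity)
    have := neg_abs_le β₁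
    linarith
  · refine lt_of_mul_lt_mul_left ?_ hq.le
    have : (1 : ℤ) * (b : ℤ) ^ (n + 1) ≤ c * (b * w - S.q * r) * (b : ℤ) ^ (n + 1) :=
      mul_le_mul_of_nonneg_right (mul_pos hc0 (sub_pos.mpr hw)) (by positivity)
    calc S.q * ((S.push b a).push b c).q = S.q * (c * r * (b : ℤ) ^ (n + 1) + β₁) := by rw [hQ]
      _ < b * (c * w * (b : ℤ) ^ (n + 1) + β₂) := by linarith
      _ = _ := by rw [← hR]; ring
  · refine lt_of_mul_lt_mul_left ?_ hq.le
    have : (1 : ℤ) * (b : ℤ) ^ (n + 1) ≤ c * (S.q * r - w) * (b : ℤ) ^ (n + 1) :=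
      mul_le_mul_of_nonneg_right (mul_pos hc0 (sub_pos.mpr hwv)) (by positivity)
    rw [hR, hQ]
    linarith
  · refine lt_of_eq_of_lt ?_ hl1
    rw [hS, pow_add, pow_add, hDD, hGG]; ring

theorem exists_good_of_sq_add {b k : ℕ} (hk : 1 ≤ k) (h₁ : k ^ 2 + 1 ≤ b) (h₂ : b ≤ k ^ 2 + k) :
    ∃ a c : ℕ, 0 < a ∧ 0 < c ∧ ((empty.push b a).push b c).Good b := by
  have hkb : k < b := by nlinarith
  have hb : 2 ≤ b := by omega
  have hb' : (2 : ℤ) ≤ b := by exact_mod_cast hb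
  have hk' : (1 : ℤ) ≤ k := by exact_mod_cast hk
  have hkb' : (k : ℤ) < b := by exact_mod_cast hkb
  obtain ⟨j, hj⟩ : ∃ j : ℤ, (b : ℤ) = k ^ 2 + j := ⟨b - k ^ 2, by ring⟩
  have hj1 : 1 ≤ j := by zify at h₁; linarith
  have hjk : j ≤ k := by zify at h₂; linarith
  obtain ⟨M, hM⟩ : ∃ M : ℕ, 2 * ((b : ℤ) + k) + 2 * (k + 1) * ((b + k) * (b + k))
      + 4 * k * ((b : ℤ) ^ 2 * b) + b * ((b + k) * (b + k)) ≤ M := ⟨_, Int.self_le_toNat _⟩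
  -- the residue `ρ` lies in `(b / j, b / j + k]`
  obtain ⟨ρ, hρk, hρ1, hρ2, hρ3⟩ : ∃ ρ : ℤ, (k : ℤ) ∣ (b : ℤ) ^ (M + 1) * j - ρ ∧ b < j * ρ ∧
      j * ρ ≤ b + j * k ∧ ρ ≤ b + k := by
    have e0 := Int.mul_ediv_add_emod (b : ℤ) j
    have e1 := Int.emod_nonneg (b : ℤ) (by omega : j ≠ 0)
    have e2 := Int.emod_lt_of_pos (b : ℤ) (by omega : 0 < j)
    generalize (b : ℤ) / j = e at *
    have e3 := Int.emod_nonneg ((b : ℤ) ^ (M + 1) * j - e - 1) (by omega : (k : ℤ) ≠ 0)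
    have e4 := Int.emod_lt_of_pos ((b : ℤ) ^ (M + 1) * j - e - 1) (by omega : 0 < (k : ℤ))
    have e5 : (k : ℤ) ∣ ((b : ℤ) ^ (M + 1) * j - e - 1) -
      ((b : ℤ) ^ (M + 1) * j - e - 1) % k := Int.dvd_self_sub_emod
    generalize ((b : ℤ) ^ (M + 1) * j - e - 1) % k = f at *
    refine ⟨e + 1 + f, by convert e5 using 1; ring, by nlinarith, by nlinarith, ?_⟩
    have : e ≤ b := by
      by_contra! h0
      nlinarith
    linarith
  have hρk' : (k : ℤ) < ρ := by
    by_contra! h0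
    nlinarith
  have hρρ : ρ * (ρ - 1) ≤ (b + k) * (b + k) := by nlinarith
  have hρρ0 : 0 < ρ * (ρ - 1) := mul_pos (by omega) (by omega)
  have hbk : 0 ≤ k * ((b : ℤ) ^ 2 * b) := by positivity
  have hkρ : 0 ≤ (k + 1) * (((b : ℤ) + k) * (b + k)) := by positivity
  have hbρ : 0 ≤ b * (((b : ℤ) + k) * (b + k)) := by positivity
  have hB0 : 0 < (b : ℤ) ^ (M + 1) := by positivity
  obtain ⟨a, ha, halen⟩ := exists_quotient hb (m := M) (ρ := ρ) (q := k) (r := j) (by omega)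
    (by nlinarith)
    (by linarith [mul_le_mul_of_nonneg_left hjk (by positivity : 0 ≤ (b : ℤ) ^ M * b)])
    (by linarith) hρk
  have hklen : digLen b k = 1 := digLen_eq hb (by simpa using hk) (by simpa using hkb)
  have hBm : ((M + 1 : ℕ) : ℤ) < (b : ℤ) ^ (M + 1) := by
    exact_mod_cast Nat.lt_pow_self (n := M + 1) (by omega : 1 < b)
  have hQ : ((empty.push b k).push b a).q = j * (b : ℤ) ^ (M + 1) + -(ρ - 1) := by
    simp only [push, empty]; linear_combination -ha
  have hR : k * ((empty.push b k).push b a).rem b =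
      (j * ρ - b) * (b : ℤ) ^ (M + 1) + -(ρ * (ρ - 1)) := by
    simp only [push, empty, rem, halen, hklen]
    linear_combination (a * k + 1) * (b : ℤ) ^ (M + 1) * hj + (a * k + 1 - ρ) * ha
  have hS : ((empty.push b k).push b a).s = 1 + (M + 1) := by
    simp only [push, empty, halen, hklen]
  have ha0 : 0 < a := by
    by_contra h0
    have : a = 0 := by omega
    subst this
    simp [digLen] at halen
  obtain ⟨hl1, hl2, hl3⟩ := affine_large hb hk' hj1
    (by linarith : 1 ≤ j * ρ - b) (by omega) (by omega)
    (by positivity : 0 ≤ (b : ℤ) ^ 2 * b) hQ hR (by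
      rw [abs_neg, abs_neg, abs_of_pos hρρ0, abs_of_pos (by omega : 0 < ρ - 1)]
      have := mul_le_mul_of_nonneg_left hρρ (by omega : (0 : ℤ) ≤ 2 * (k + 1))
      push_cast
      linarith)
  push_cast at hBm
  refine ⟨k, a, by omega, ha0, (det_push_push b empty k a).trans (by simp [empty]), ?_, ?_, ?_, ?_,
    hl2, hl3⟩
  · rw [hQ]
    nlinarith
  · refine lt_of_mul_lt_mul_left ?_ (by omega : (0 : ℤ) ≤ k)
    have h3 : (1 : ℤ) * (b : ℤ) ^ (M + 1) ≤ (b * (j * ρ - b) - k * j) * (b : ℤ) ^ (M + 1) :=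
      mul_le_mul_of_nonneg_right (by nlinarith) hB0.le
    have h4 := mul_le_mul_of_nonneg_left hρρ (by omega : (0 : ℤ) ≤ b)
    have h5 : 0 ≤ (k : ℤ) * (ρ - 1) := mul_nonneg (by omega) (by omega)
    calc k * ((empty.push b k).push b a).q = k * (j * (b : ℤ) ^ (M + 1) + -(ρ - 1)) := by rw [hQ]
      _ < b * ((j * ρ - b) * (b : ℤ) ^ (M + 1) + -(ρ * (ρ - 1))) := by linarith
      _ = _ := by rw [← hR]; ring
  · refine lt_of_mul_lt_mul_left ?_ (by omega : (0 : ℤ) ≤ k)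
    have h3 : (j * ρ - b) * (b : ℤ) ^ (M + 1) ≤ (k * j) * (b : ℤ) ^ (M + 1) :=
      mul_le_mul_of_nonneg_right (by linarith) hB0.le
    have h4 : k * (ρ - 1) < ρ * (ρ - 1) := mul_lt_mul_of_pos_right hρk' (by omega)
    rw [hR, hQ]
    linarith
  · refine lt_of_eq_of_lt ?_ hl1
    rw [hS, pow_add]; ring

theorem not_dvdPow_of_prime {b p : ℕ} {x : ℤ} (hp : p.Prime) (hpx : (p : ℤ) ∣ x)
    (hpb : ¬ p ∣ b) : ¬ DvdPow b x := by
  rintro ⟨M, hM⟩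
  have := (Nat.prime_iff_prime_int.mp hp).dvd_of_dvd_pow (hpx.trans hM)
  exact hpb (by exact_mod_cast this)

theorem good_three : ((((empty.push 3 1).push 3 1).push 3 44).push 3 15).Good 3 := by
  have h1 : digLen 3 1 = 1 := digLen_eq (by norm_num) (by norm_num) (by norm_num)
  have h2 : digLen 3 44 = 4 := digLen_eq (by norm_num) (by norm_num) (by norm_num)
  have h3 : digLen 3 15 = 3 := digLen_eq (by norm_num) (by norm_num) (by norm_num)
  have hS : (((empty.push 3 1).push 3 1).push 3 44).push 3 15 =
      ⟨676, 45, 1337, 89, 9951, 9⟩ := by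
    simp [push, empty, h1, h2, h3]
  rw [hS]
  refine ⟨by norm_num, by norm_num, by norm_num [rem], by norm_num [rem], by norm_num [rem],
    not_dvdPow_of_prime (p := 7) (by norm_num) (by norm_num) (by norm_num),
    not_dvdPow_of_prime (p := 11) (by norm_num) (by norm_num [rem]) (by norm_num)⟩

end ConvState

theorem cfVal_nonneg (l : List ℕ) : 0 ≤ cfVal l := by
  induction l with
  | nil => simp [cfVal]
  | cons h t ih => simp only [cfVal]; positivity

theorem cfVal_cons_le {h : ℕ} (hh : 0 < h) (t : List ℕ) : cfVal (h :: t) ≤ 1 / h := by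
  simp only [cfVal]
  have : (0 : ℝ) < h := by exact_mod_cast hh
  exact one_div_le_one_div_of_le this (by linarith [cfVal_nonneg t])

theorem cfVal_le_one {l : List ℕ} (hl : ∀ x ∈ l, 0 < x) : cfVal l ≤ 1 := by
  cases l with
  | nil => simp [cfVal]
  | cons h t =>
    have hh : 0 < h := hl h (by simp)
    refine (cfVal_cons_le hh t).trans ?_
    have : (1 : ℝ) ≤ h := by exact_mod_cast hh
    rw [div_le_one (by linarith)]
    exact this

/-- The tail of a convergent infinite continued fraction converges. -/
theorem tendsto_cfVal_tail {a : ℕ → ℕ} (ha : ∀ i, 0 < a i) {x : ℝ}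
    (hx : Tendsto (fun n => cfVal ((List.range n).map a)) atTop (𝓝 x)) :
    0 < x ∧ Tendsto (fun n => cfVal ((List.range n).map fun i => a (i + 1))) atTop
      (𝓝 (1 / x - a 0)) := by
  have e : ∀ n, cfVal ((List.range (n + 1)).map a) =
      1 / ((a 0 : ℝ) + cfVal ((List.range n).map fun i => a (i + 1))) := by
    intro n
    rw [List.range_succ_eq_map, List.map_cons, List.map_map]
    rfl
  have ha0 : (0 : ℝ) < a 0 := by exact_mod_cast ha 0
  have hx1 := (tendsto_add_atTop_iff_nat 1).mpr hx
  simp only [e] at hx1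
  have hpos : 0 < x := by
    have h1 : 1 / ((a 0 : ℝ) + 1) ≤ x := by
      refine ge_of_tendsto' hx1 fun n => ?_
      refine one_div_le_one_div_of_le (by linarith [cfVal_nonneg ((List.range n).map
        fun i => a (i + 1))]) ?_
      have := cfVal_le_one (l := (List.range n).map fun i => a (i + 1)) (by simp [ha])
      linarith
    have : 0 < 1 / ((a 0 : ℝ) + 1) := by positivity
    linarith
  refine ⟨hpos, ?_⟩
  have h2 := (hx1.inv₀ hpos.ne').sub_const (a 0 : ℝ)
  simpa using h2

/-- The value of an infinite continued fraction with positive partial quotients is irrational. -/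
theorem irrational_of_tendsto_cfVal {a : ℕ → ℕ} (ha : ∀ i, 0 < a i) {x : ℝ}
    (hx : Tendsto (fun n => cfVal ((List.range n).map a)) atTop (𝓝 x)) : Irrational x := by
  suffices H : ∀ (n : ℕ) (m : ℤ) (a : ℕ → ℕ) (x : ℝ), (∀ i, 0 < a i) →
      Tendsto (fun n => cfVal ((List.range n).map a)) atTop (𝓝 x) → 0 < n → x * n ≠ m by
    rintro ⟨y, rfl⟩
    refine H y.den y.num a _ ha hx y.den_pos ?_
    exact_mod_cast Rat.mul_den_eq_num y
  intro n
  induction n using Nat.strong_induction_on with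
  | _ n ih =>
    intro m a x ha hx hn hxm
    obtain ⟨h0, h1⟩ := tendsto_cfVal_tail ha hx
    obtain ⟨h2, -⟩ := tendsto_cfVal_tail (fun i => ha (i + 1)) h1
    have hn' : (0 : ℝ) < n := by exact_mod_cast hn
    have ha0 : (1 : ℝ) ≤ a 0 := by exact_mod_cast ha 0
    have hx1 : x < 1 := by
      have h3 : 1 < 1 / x := by linarith
      rwa [lt_div_iff₀ h0, one_mul] at h3
    have hm0 : (0 : ℝ) < m := by rw [← hxm]; positivity
    have hmn : (m : ℝ) < n := by rw [← hxm]; nlinarith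
    lift m to ℕ using by exact_mod_cast hm0.le
    refine ih m (by exact_mod_cast hmn) (n - a 0 * m) (fun i => a (i + 1)) _
      (fun i => ha (i + 1)) h1 (by exact_mod_cast hm0) ?_
    push_cast at hxm ⊢
    rw [← hxm]
    field_simp

namespace ConvState

/-- The data attached to a list of partial quotients. -/
def ofList (b : ℕ) (l : List ℕ) : ConvState := l.foldl (push b) empty

theorem ofList_append_singleton (b : ℕ) (l : List ℕ) (a : ℕ) :
    ofList b (l ++ [a]) = (ofList b l).push b a := by
  simp [ofList]

theorem ofList_q_pos (b : ℕ) {l : List ℕ} (hl : ∀ x ∈ l, 0 < x) :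
    0 < (ofList b l).q ∧ 0 ≤ (ofList b l).q' := by
  induction l using List.reverseRecOn with
  | nil => simp [ofList, empty]
  | append_singleton l a ih =>
    obtain ⟨h1, h2⟩ := ih fun x hx => hl x (by simp [hx])
    have ha : 0 < (a : ℤ) := by exact_mod_cast hl a (by simp)
    rw [ofList_append_singleton]
    refine ⟨?_, h1.le⟩
    have := mul_pos ha h1
    simp only [push]
    linarith

/-- The value of a continued fraction as a Möbius function of the value of its tail. -/
theorem cfVal_append (b : ℕ) {l : List ℕ} (hl : ∀ x ∈ l, 0 < x) (t : List ℕ) :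
    cfVal (l ++ t) = ((ofList b l).p + (ofList b l).p' * cfVal t) /
      ((ofList b l).q + (ofList b l).q' * cfVal t) := by
  induction l using List.reverseRecOn generalizing t with
  | nil => simp [ofList, empty]
  | append_singleton l a ih =>
    have hl' : ∀ x ∈ l, 0 < x := fun x hx => hl x (by simp [hx])
    obtain ⟨h1, h2⟩ := ofList_q_pos b hl'
    have h1' : (0 : ℝ) < (ofList b l).q := by exact_mod_cast h1
    have h2' : (0 : ℝ) ≤ (ofList b l).q' := by exact_mod_cast h2
    have ha : (0 : ℝ) < a := by exact_mod_cast hl a (by simp)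
    have ht := cfVal_nonneg t
    rw [List.append_assoc, ih hl', ofList_append_singleton]
    simp only [push, List.singleton_append, cfVal]
    push_cast
    have h3 : 0 < (a : ℝ) + cfVal t := by linarith
    have h4 : 0 < (a : ℝ) * (ofList b l).q + (ofList b l).q' + (ofList b l).q * cfVal t := by
      positivity
    have h5 : 0 < ((ofList b l).q : ℝ) + (ofList b l).q' * (1 / (a + cfVal t)) := by
      positivity
    rw [div_eq_div_iff h5.ne' h4.ne']
    field_simp
    ring

theorem cfVal_eq (b : ℕ) {l : List ℕ} (hl : ∀ x ∈ l, 0 < x) :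
    cfVal l = (ofList b l).p / (ofList b l).q := by
  simpa [cfVal] using cfVal_append b hl []

theorem Good.abs_cfVal_append_sub_le {b : ℕ} {l : List ℕ} (hl : ∀ x ∈ l, 0 < x)
    (h : (ofList b l).Good b) (t : List ℕ) :
    |cfVal (l ++ t) - cfVal l| ≤ cfVal t / ((ofList b l).q : ℝ) ^ 2 := by
  obtain ⟨h1, h2⟩ := ofList_q_pos b hl
  have h1' : (0 : ℝ) < (ofList b l).q := by exact_mod_cast h1
  have h2' : (0 : ℝ) ≤ (ofList b l).q' := by exact_mod_cast h2
  have hdet : ((ofList b l).q : ℝ) * (ofList b l).p' - (ofList b l).q' * (ofList b l).p = 1 := by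
    exact_mod_cast h.det
  have ht := cfVal_nonneg t
  rw [cfVal_append b hl, cfVal_eq b hl]
  have h4 : (0 : ℝ) < (ofList b l).q + (ofList b l).q' * cfVal t := by positivity
  have h5 : ((ofList b l).p + (ofList b l).p' * cfVal t) /
      ((ofList b l).q + (ofList b l).q' * cfVal t) - ((ofList b l).p : ℝ) / (ofList b l).q =
      cfVal t / (((ofList b l).q + (ofList b l).q' * cfVal t) * (ofList b l).q) := by
    rw [div_sub_div _ _ h4.ne' h1'.ne']
    congr 1
    linear_combination cfVal t * hdet
  rw [h5, abs_of_nonneg (by positivity)]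
  refine div_le_div_of_nonneg_left ht (by positivity) ?_
  rw [sq]
  exact mul_le_mul_of_nonneg_right (by nlinarith) h1'.le

theorem Good.abs_cfVal_append_sub_digits_le {b : ℕ} (hb : 2 ≤ b) {l t : List ℕ}
    (hl : ∀ x ∈ l, 0 < x) (ht : ∀ x ∈ t, 0 < x) (h : (ofList b l).Good b) :
    |cfVal (l ++ t) - (ofList b l).N / (b : ℝ) ^ (ofList b l).s| ≤
      2 / (b : ℝ) ^ (ofList b l).s := by
  have h0 := h.abs_cfVal_append_sub_le hl t
  have hq : (0 : ℝ) < (ofList b l).q := by exact_mod_cast h.q_pos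
  have hr : (0 : ℝ) < (ofList b l).rem b := by exact_mod_cast h.rem_pos
  have hup : ((ofList b l).rem b : ℝ) < (ofList b l).q := by exact_mod_cast h.upper
  have hlarge : (b : ℝ) ^ 2 * (b : ℝ) ^ (ofList b l).s <
    (ofList b l).q * (ofList b l).rem b := by exact_mod_cast h.large
  have hb' : (2 : ℝ) ≤ b := by exact_mod_cast hb
  have hrem : ((ofList b l).rem b : ℝ) = (b : ℝ) ^ (ofList b l).s * (ofList b l).p -
    (ofList b l).N * (ofList b l).q := by simp [rem]
  have ht1 := cfVal_le_one ht
  rw [cfVal_eq b hl] at h0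
  have hB : 0 < (b : ℝ) ^ (ofList b l).s := by positivity
  generalize (b : ℝ) ^ (ofList b l).s = B at *
  have hBq : B ≤ ((ofList b l).q : ℝ) ^ 2 := by
    have e1 : 1 * B ≤ (b : ℝ) ^ 2 * B := mul_le_mul_of_nonneg_right (by nlinarith) hB.le
    have e2 := mul_le_mul_of_nonneg_left hup.le hq.le
    rw [sq]
    linarith
  have h1 : cfVal t / ((ofList b l).q : ℝ) ^ 2 ≤ 1 / B := div_le_div₀ zero_le_one ht1 hB hBq
  have h2 : ((ofList b l).p : ℝ) / (ofList b l).q - (ofList b l).N / B =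
      ((ofList b l).rem b / (ofList b l).q) / B := by
    rw [hrem]; field_simp
  have h3 : ((ofList b l).rem b : ℝ) / (ofList b l).q ≤ 1 := (div_le_one hq).mpr hup.le
  have h4 : |((ofList b l).p : ℝ) / (ofList b l).q - (ofList b l).N / B| ≤ 1 / B := by
    rw [h2, abs_of_nonneg (by positivity)]
    exact div_le_div_of_nonneg_right h3 hB.le
  calc _ ≤ _ := abs_sub_le _ (((ofList b l).p : ℝ) / (ofList b l).q) _
    _ ≤ 1 / B + 1 / B := by linarith
    _ = 2 / B := by ring

theorem ofList_map_range_s (b : ℕ) (a : ℕ → ℕ) (n : ℕ) :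
    (ofList b ((List.range n).map a)).s = ∑ j ∈ Finset.range n, digLen b (a j) := by
  induction n with
  | zero => simp [ofList, empty]
  | succ n ih =>
    rw [List.range_succ, List.map_append, List.map_singleton, ofList_append_singleton,
      Finset.sum_range_succ, ← ih]
    rfl

/-- The integer with the concatenated digits, in terms of the partial sums. -/
theorem ofList_map_range_N {b : ℕ} (hb : 2 ≤ b) (a : ℕ → ℕ) (n : ℕ) :
    ((ofList b ((List.range n).map a)).N : ℝ) / (b : ℝ) ^ (ofList b ((List.range n).map a)).s =
      ∑ i ∈ Finset.range n, (a i : ℝ) / (b : ℝ) ^ (∑ j ∈ Finset.range (i + 1), digLen b (a j)) := by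
  induction n with
  | zero => simp [ofList, empty]
  | succ n ih =>
    have hb' : (b : ℝ) ≠ 0 := by positivity
    rw [Finset.sum_range_succ, ← ih, Finset.sum_range_succ, ← ofList_map_range_s,
      List.range_succ, List.map_append, List.map_singleton, ofList_append_singleton]
    simp only [push]
    push_cast
    rw [pow_add]
    field_simp

end ConvState

theorem summable_digits {b : ℕ} (hb : 2 ≤ b) {a : ℕ → ℕ} (ha : ∀ i, 0 < a i) :
    Summable fun i : ℕ => (a i : ℝ) / (b : ℝ) ^ (∑ j ∈ Finset.range (i + 1), digLen b (a j)) := by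
  have hb' : (2 : ℝ) ≤ b := by exact_mod_cast hb
  refine Summable.of_nonneg_of_le (fun i => by positivity) (fun i => ?_) summable_geometric_two
  have h1 : (a i : ℝ) ≤ (b : ℝ) ^ digLen b (a i) := by
    exact_mod_cast (lt_base_pow_digLen hb (a i)).le
  have h2 : i ≤ ∑ j ∈ Finset.range i, digLen b (a j) := by
    simpa using Finset.card_nsmul_le_sum (Finset.range i) (fun j => digLen b (a j)) 1
      fun j _ => digLen_pos hb (ha j)
  have h3 : (2 : ℝ) ^ i ≤ (b : ℝ) ^ (∑ j ∈ Finset.range i, digLen b (a j)) :=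
    (pow_le_pow_left₀ (by norm_num) hb' i).trans (pow_le_pow_right₀ (by linarith) h2)
  rw [Finset.sum_range_succ, pow_add, div_pow, one_pow]
  rw [div_le_div_iff₀ (by positivity) (by positivity), one_mul, mul_comm]
  exact mul_le_mul h3 h1 (by positivity) (by positivity)

/-- A chain of lists of unbounded length consists of the initial segments of a sequence. -/
theorem exists_seq_of_prefix {L : ℕ → List ℕ} (hL : ∀ i, L i <+: L (i + 1))
    (hlen : ∀ i, i ≤ (L i).length) :
    ∃ a : ℕ → ℕ, ∀ i, L i = (List.range (L i).length).map a := by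
  have hmono : ∀ i j, i ≤ j → L i <+: L j := fun i j hij => by
    induction hij with
    | refl => exact List.prefix_rfl
    | step _ ih => exact ih.trans (hL _)
  refine ⟨fun n => (L (n + 1)).getD n 0, fun i => ?_⟩
  refine List.ext_getElem (by simp) fun n h₁ _ => ?_
  have h₂ : n < (L (n + 1)).length := hlen (n + 1)
  simp only [List.getElem_map, List.getElem_range, List.getD_eq_getElem _ _ h₂]
  rcases le_total i (n + 1) with h | h
  · exact (hmono _ _ h).getElem h₁
  · exact ((hmono _ _ h).getElem h₂).symm

theorem map_range_add {a : ℕ → ℕ} (n m : ℕ) : (List.range (n + m)).map a =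
    (List.range n).map a ++ (List.range m).map fun i => a (n + i) := by
  simp [List.range_add, Function.comp_def]

/-- If infinitely many initial segments of a sequence are good, it defines a Trott number. -/
theorem exists_isTrottWith_of_good {b : ℕ} (hb : 2 ≤ b) {a : ℕ → ℕ} (ha : ∀ i, 0 < a i)
    (h : ∀ m, ∃ n, m ≤ n ∧ (ConvState.ofList b ((List.range n).map a)).Good b) :
    ∃ x, IsTrottWith b x a := by
  refine ⟨_, ha, ?_, rfl⟩
  have hsum := (summable_digits hb ha).hasSum.tendsto_sum_nat
  have hb' : (2 : ℝ) ≤ b := by exact_mod_cast hb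
  rw [Metric.tendsto_atTop] at hsum ⊢
  intro ε hε
  obtain ⟨m₁, hm₁⟩ := hsum (ε / 2) (half_pos hε)
  obtain ⟨m₂, hm₂⟩ := exists_pow_lt_of_lt_one (show 0 < ε / 4 by positivity) one_half_lt_one
  obtain ⟨n, hn, hgood⟩ := h (max m₁ m₂)
  refine ⟨n, fun k hk => ?_⟩
  obtain ⟨r, rfl⟩ := Nat.exists_eq_add_of_le hk
  have h₁ := hm₁ n (le_of_max_le_left hn)
  have h₂ := hgood.abs_cfVal_append_sub_digits_le hb (by simp [ha])
    (t := (List.range r).map fun i => a (n + i)) (by simp [ha])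
  rw [← map_range_add, ConvState.ofList_map_range_N hb] at h₂
  have hs : n ≤ (ConvState.ofList b ((List.range n).map a)).s := by
    rw [ConvState.ofList_map_range_s]
    simpa using Finset.card_nsmul_le_sum (Finset.range n) (fun j => digLen b (a j)) 1
      fun j _ => digLen_pos hb (ha j)
  have h₃ : 2 / (b : ℝ) ^ (ConvState.ofList b ((List.range n).map a)).s ≤ 2 * (1 / 2) ^ m₂ := by
    rw [div_pow, one_pow, mul_one_div]
    refine div_le_div_of_nonneg_left (by norm_num) (by positivity) ?_
    exact (pow_le_pow_left₀ (by norm_num) hb' m₂).trans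
      (pow_le_pow_right₀ (by linarith) ((le_of_max_le_right hn).trans hs))
  rw [Real.dist_eq] at h₁ ⊢
  refine (abs_sub_le _ _ _).trans_lt (add_lt_add_of_le_of_lt (h₂.trans h₃) h₁ |>.trans_le ?_)
  linarith

theorem IsTrottWith.abs_sub_cfVal_le {b : ℕ} {a : ℕ → ℕ} {x : ℝ} (hx : IsTrottWith b x a)
    {n : ℕ} (h : (ConvState.ofList b ((List.range n).map a)).Good b) :
    |x - cfVal ((List.range n).map a)| ≤ 1 / a n := by
  obtain ⟨ha, hlim, -⟩ := hx
  refine le_of_tendsto (hlim.sub_const (cfVal ((List.range n).map a))).abs ?_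
  filter_upwards [eventually_ge_atTop (n + 1)] with k hk
  obtain ⟨r, rfl⟩ := Nat.exists_eq_add_of_le hk
  rw [add_assoc, map_range_add n (1 + r)]
  have hq : (1 : ℝ) ≤ (ConvState.ofList b ((List.range n).map a)).q := by
    exact_mod_cast h.q_pos
  refine (h.abs_cfVal_append_sub_le (by simp [ha]) _).trans
    ((div_le_self (cfVal_nonneg _) (one_le_pow₀ hq)).trans ?_)
  rw [add_comm 1 r, List.range_succ_eq_map, List.map_cons]
  exact cfVal_cons_le (ha n) _

/-- A good list can be extended so that all its further extensions avoid a given closed set of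
Trott numbers. -/
theorem ConvState.Good.exists_append_avoiding {b : ℕ} (hb : 2 ≤ b) {l : List ℕ}
    (hl : ∀ x ∈ l, 0 < x) (h : (ofList b l).Good b) {F : Set ℝ} (hF : IsClosed F)
    (hFT : F ⊆ TrottSet b) :
    ∃ u v : ℕ, 0 < u ∧ 0 < v ∧ (ofList b (l ++ [u, v])).Good b ∧
      ∀ z ∈ F, 1 / (u : ℝ) < |z - cfVal l| := by
  have hnot : cfVal l ∉ F := fun hmem => by
    obtain ⟨a, ha, hlim, -⟩ := hFT hmem
    refine irrational_of_tendsto_cfVal ha hlim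
      ⟨((ofList b l).p : ℚ) / (ofList b l).q, ?_⟩
    rw [cfVal_eq b hl]
    push_cast
    rfl
  obtain ⟨ε, hε, hball⟩ := Metric.isOpen_iff.mp hF.isOpen_compl _ hnot
  obtain ⟨K, hK⟩ := exists_nat_one_div_lt hε
  obtain ⟨u, v, hu, hu₀, hv, hgood⟩ := h.exists_push hb (K + 1)
  refine ⟨u, v, hu₀, hv, by simpa [ofList] using hgood, fun z hz => ?_⟩
  have hdist : ε ≤ |z - cfVal l| := by
    by_contra! hlt
    exact hball (Metric.mem_ball.mpr hlt) hz
  have hKu : (K : ℝ) + 1 ≤ u := by exact_mod_cast hu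
  exact ((one_div_le_one_div_of_le (by positivity) hKu).trans_lt hK).trans_le hdist

theorem exists_good_list {b : ℕ} (hΓ : b ∈ Gamma) :
    ∃ l : List ℕ, (∀ x ∈ l, 0 < x) ∧ (ConvState.ofList b l).Good b := by
  rcases hΓ with rfl | ⟨k, hk, h₁, h₂⟩
  · exact ⟨[1, 1, 44, 15], by simp, ConvState.good_three⟩
  · obtain ⟨a, c, ha, hc, h⟩ := ConvState.exists_good_of_sq_add hk h₁ h₂
    exact ⟨[a, c], by simp [ha, hc], h⟩

/-- For `b ∈ Γ`, the set of Trott numbers in base `b` is not an `Fσ` subset of `ℝ`,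
i.e. it is not a countable union of closed sets. -/
theorem trottSet_not_Fsigma (b : ℕ) (hb : 2 ≤ b) (hΓ : b ∈ Gamma) :
    ¬ ∃ F : ℕ → Set ℝ, (∀ n, IsClosed (F n)) ∧ TrottSet b = ⋃ n, F n := by
  rintro ⟨F, hF, hT⟩
  let G := {l : List ℕ // (∀ x ∈ l, 0 < x) ∧ (ConvState.ofList b l).Good b}
  have step : ∀ (i : ℕ) (l : G), ∃ (m : G) (u v : ℕ), m.1 = l.1 ++ [u, v] ∧
      ∀ z ∈ F i, 1 / (u : ℝ) < |z - cfVal l.1| := by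
    rintro i ⟨l, hl, hgood⟩
    obtain ⟨u, v, hu, hv, hgood', hz⟩ := hgood.exists_append_avoiding hb hl (hF i)
      (hT ▸ Set.subset_iUnion F i)
    refine ⟨⟨l ++ [u, v], fun x hx => ?_, hgood'⟩, u, v, rfl, hz⟩
    simp only [List.mem_append, List.mem_cons, List.not_mem_nil, or_false] at hx
    rcases hx with hx | rfl | rfl
    exacts [hl x hx, hu, hv]
  choose next u v hnext hz using step
  obtain ⟨l₀, hl₀⟩ := exists_good_list hΓ
  obtain ⟨L, hL⟩ : ∃ L : ℕ → G, ∀ i, (L (i + 1)).1 = (L i).1 ++ [u i (L i), v i (L i)] :=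
    ⟨fun i => Nat.rec ⟨l₀, hl₀⟩ next i, fun i => hnext i _⟩
  have hlen : ∀ i, i ≤ (L i).1.length := fun i => by
    induction i with
    | zero => exact Nat.zero_le _
    | succ i ih => rw [hL]; simp; lia
  obtain ⟨a, ha⟩ : ∃ a : ℕ → ℕ, ∀ i, (L i).1 = (List.range (L i).1.length).map a :=
    exists_seq_of_prefix (fun i => ⟨_, (hL i).symm⟩) hlen
  have hpos : ∀ n, 0 < a n := fun n => by
    have hmem : a n ∈ (L (n + 1)).1 := by
      rw [ha (n + 1)]
      exact List.mem_map_of_mem (List.mem_range.mpr (hlen (n + 1)))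
    exact (L (n + 1)).2.1 _ hmem
  have hgood : ∀ i, (ConvState.ofList b ((List.range (L i).1.length).map a)).Good b := fun i =>
    ha i ▸ (L i).2.2
  have hu : ∀ i, a (L i).1.length = u i (L i) := fun i => by
    have e := ha (i + 1)
    have hlen' : (L (i + 1)).1.length = (L i).1.length + 2 := by simp [hL i]
    rw [hlen', map_range_add, ← ha i, hL i] at e
    simpa [List.range_succ] using (congrArg List.head? (List.append_cancel_left e)).symm
  obtain ⟨x, hx⟩ := exists_isTrottWith_of_good hb hpos fun m => ⟨_, hlen m, hgood m⟩
  have hxT : x ∈ TrottSet b := ⟨a, hx⟩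
  rw [hT, Set.mem_iUnion] at hxT
  obtain ⟨i, hi⟩ := hxT
  have h₁ := hx.abs_sub_cfVal_le (hgood i)
  rw [hu i, ← ha i] at h₁
  exact absurd h₁ (not_le.mpr (hz i (L i) x hi))
end

section
/- The set T := ⋃_{b≥2} T_b of all real numbers that are Trott in some integer base b ≥ 2 is nowhere dense in the real line. -/
open Filter Topology

/-- `[0; l, 1/t]`: the continued fraction with partial quotients `l` followed by the tail `t`. -/
noncomputable def cfExtend : List ℕ → ℝ → ℝ
  | [], t => t
  | (h :: l), t => 1 / ((h : ℝ) + cfExtend l t)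

/-- The number whose base-`b` expansion starts with the digit strings of `l`, followed by
that of `t`. -/
noncomputable def digExtend (b : ℕ) : List ℕ → ℝ → ℝ
  | [], t => t
  | (h :: l), t => ((h : ℝ) + digExtend b l t) / (b : ℝ) ^ digLen b h

/-- The number whose base-`b` expansion is the concatenation of the digit strings of the `a i`. -/
noncomputable def concatVal (b : ℕ) (a : ℕ → ℕ) : ℝ :=
  ∑' i : ℕ, (a i : ℝ) / (b : ℝ) ^ (∑ j ∈ Finset.range (i + 1), digLen b (a j))

/-! ### Continued fractions -/

lemma cfExtend_zero (l : List ℕ) : cfExtend l 0 = cfVal l := by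
  induction l with
  | nil => rfl
  | cons h l ih => simp [cfExtend, cfVal, ih]

lemma cfExtend_append_singleton (l : List ℕ) (m : ℕ) (t : ℝ) :
    cfExtend (l ++ [m]) t = cfExtend l (1 / (m + t)) := by
  induction l with
  | nil => rfl
  | cons h l ih => simp [cfExtend, ih]

lemma cfExtend_nonneg (l : List ℕ) {t : ℝ} (ht : 0 ≤ t) : 0 ≤ cfExtend l t := by
  induction l with
  | nil => exact ht
  | cons h l ih => simp only [cfExtend]; positivity

lemma cfExtend_mem_Ioo {l : List ℕ} (hl : ∀ h ∈ l, 0 < h) {t : ℝ} (ht : t ∈ Set.Ioo (0 : ℝ) 1) :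
    cfExtend l t ∈ Set.Ioo (0 : ℝ) 1 := by
  induction l with
  | nil => exact ht
  | cons h l ih =>
    have hh : (1 : ℝ) ≤ h := by exact_mod_cast hl h (by simp)
    have h1 := ih fun k hk => hl k (by simp [hk])
    simp only [cfExtend]
    refine ⟨by have := h1.1; positivity, ?_⟩
    rw [div_lt_one] <;> linarith [h1.1]

lemma continuousOn_cfExtend {l : List ℕ} (hl : ∀ h ∈ l, 0 < h) :
    ContinuousOn (cfExtend l) (Set.Ici 0) := by
  induction l with
  | nil => exact continuousOn_id
  | cons h l ih =>
    have hh : (0 : ℝ) < h := by exact_mod_cast hl h (by simp)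
    simp only [cfExtend]
    refine continuousOn_const.div (continuousOn_const.add (ih fun k hk => hl k (by simp [hk]))) ?_
    intro t ht
    have := cfExtend_nonneg l ht
    positivity

lemma isOpen_image_cfExtend (l : List ℕ) {s : Set ℝ} (hs : IsOpen s) (hpos : s ⊆ Set.Ioi 0) :
    IsOpen (cfExtend l '' s) ∧ cfExtend l '' s ⊆ Set.Ioi 0 := by
  induction l with
  | nil => simpa [cfExtend] using ⟨hs, hpos⟩
  | cons h l ih =>
    obtain ⟨ho, hp⟩ := ih
    have key : cfExtend (h :: l) '' s =
        Set.Ioi 0 ∩ (fun y : ℝ => 1 / y - h) ⁻¹' (cfExtend l '' s) := by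
      ext y
      constructor
      · rintro ⟨t, ht, rfl⟩
        have : 0 < cfExtend l t := hp ⟨t, ht, rfl⟩
        refine ⟨?_, t, ht, ?_⟩
        · simp only [cfExtend, Set.mem_Ioi]; positivity
        · simp [cfExtend]
      · rintro ⟨-, t, ht, he⟩
        refine ⟨t, ht, ?_⟩
        simp only [cfExtend, he]
        simp
    rw [key]
    refine ⟨ContinuousOn.isOpen_inter_preimage ?_ isOpen_Ioi ho, Set.inter_subset_left⟩
    exact (continuousOn_const.div continuousOn_id fun y hy => ne_of_gt hy).sub continuousOn_const

lemma cfVal_mem_Icc {l : List ℕ} (hl : ∀ h ∈ l, 0 < h) : cfVal l ∈ Set.Icc (0 : ℝ) 1 := by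
  induction l with
  | nil => simp [cfVal]
  | cons h l ih =>
    have hh : (1 : ℝ) ≤ h := by exact_mod_cast hl h (by simp)
    have h1 := ih fun k hk => hl k (by simp [hk])
    simp only [cfVal]
    refine ⟨by have := h1.1; positivity, ?_⟩
    rw [div_le_one] <;> linarith [h1.1]

/-- The tail of a convergent continued fraction converges. -/
lemma exists_tail_tendsto_cfVal {a : ℕ → ℕ} {y : ℝ} (ha : ∀ i, 0 < a i)
    (hy : Tendsto (fun n => cfVal ((List.range n).map a)) atTop (𝓝 y)) :
    ∃ z, Tendsto (fun n => cfVal ((List.range n).map fun i => a (i + 1))) atTop (𝓝 z) ∧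
      0 ≤ z ∧ z ≤ 1 ∧ y = 1 / (a 0 + z) := by
  have h0 : (1 : ℝ) ≤ a 0 := by exact_mod_cast ha 0
  have hmem : ∀ n, cfVal ((List.range n).map fun i => a (i + 1)) ∈ Set.Icc (0 : ℝ) 1 := fun n =>
    cfVal_mem_Icc (by simp only [List.mem_map]; rintro h ⟨i, -, rfl⟩; exact ha _)
  have hstep : ∀ n, cfVal ((List.range (n + 1)).map a) =
      1 / (a 0 + cfVal ((List.range n).map fun i => a (i + 1))) := fun n => by
    simp [List.range_succ_eq_map, cfVal, Function.comp_def]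
  have hy' := (tendsto_add_atTop_iff_nat 1).2 hy
  have hlow : 1 / ((a 0 : ℝ) + 1) ≤ y := by
    refine ge_of_tendsto' hy' fun n => ?_
    rw [hstep]
    have := hmem n
    exact one_div_le_one_div_of_le (by linarith [this.1]) (by linarith [this.2])
  have hypos : 0 < y := lt_of_lt_of_le (by positivity) hlow
  have hz : Tendsto (fun n => cfVal ((List.range n).map fun i => a (i + 1))) atTop
      (𝓝 (1 / y - a 0)) := by
    refine ((tendsto_const_nhds.div hy' hypos.ne').sub_const (a 0 : ℝ)).congr fun n => ?_
    simp [hstep]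
  exact ⟨_, hz, ge_of_tendsto' hz fun n => (hmem n).1, le_of_tendsto' hz fun n => (hmem n).2,
    by simp⟩

lemma exists_tail_cfVal {a : ℕ → ℕ} {y : ℝ} (ha : ∀ i, 0 < a i)
    (hy : Tendsto (fun n => cfVal ((List.range n).map a)) atTop (𝓝 y)) :
    ∃ z, Tendsto (fun n => cfVal ((List.range n).map fun i => a (i + 1))) atTop (𝓝 z) ∧
      z ∈ Set.Ioo (0 : ℝ) 1 ∧ y = 1 / (a 0 + z) := by
  obtain ⟨z, hz, -, -, hyz⟩ := exists_tail_tendsto_cfVal ha hy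
  obtain ⟨w, hw, hw0, hw1, hzw⟩ := exists_tail_tendsto_cfVal (fun i => ha (i + 1)) hz
  obtain ⟨v, -, hv0, -, hwv⟩ := exists_tail_tendsto_cfVal (fun i => ha (i + 1 + 1)) hw
  have h1 : (1 : ℝ) ≤ a (0 + 1) := by exact_mod_cast ha _
  have h2 : (1 : ℝ) ≤ a (0 + 1 + 1) := by exact_mod_cast ha _
  have hwpos : 0 < w := by rw [hwv]; positivity
  refine ⟨z, hz, ⟨by rw [hzw]; positivity, ?_⟩, hyz⟩
  rw [hzw, div_lt_one] <;> linarith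

/-! ### Concatenated digit strings -/

lemma digExtend_append_singleton (b : ℕ) (l : List ℕ) (m : ℕ) (t : ℝ) :
    digExtend b (l ++ [m]) t = digExtend b l ((m + t) / (b : ℝ) ^ digLen b m) := by
  induction l with
  | nil => rfl
  | cons h l ih => simp [digExtend, ih]

lemma continuous_digExtend (b : ℕ) (l : List ℕ) : Continuous (digExtend b l) := by
  induction l with
  | nil => exact continuous_id
  | cons h l ih => exact (continuous_const.add ih).div_const _

lemma digExtend_injective {b : ℕ} (hb : 2 ≤ b) (l : List ℕ) :
    Function.Injective (digExtend b l) := by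
  induction l with
  | nil => exact Function.injective_id
  | cons h l ih =>
    intro s t hst
    have : (b : ℝ) ^ digLen b h ≠ 0 := by positivity
    simp only [digExtend] at hst
    rw [div_left_inj' this] at hst
    exact ih (add_left_cancel hst)

lemma sum_concat_le {b : ℕ} (hb : 2 ≤ b) (a : ℕ → ℕ) (n : ℕ) :
    ∑ i ∈ Finset.range n, (a i : ℝ) / (b : ℝ) ^ (∑ j ∈ Finset.range (i + 1), digLen b (a j)) ≤
      1 - 1 / (b : ℝ) ^ (∑ j ∈ Finset.range n, digLen b (a j)) := by
  induction n with
  | zero => simp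
  | succ n ih =>
    rw [Finset.sum_range_succ, Finset.sum_range_succ, pow_add]
    have hlt : (a n : ℝ) + 1 ≤ (b : ℝ) ^ digLen b (a n) := by
      exact_mod_cast Nat.lt_base_pow_length_digits (m := a n) hb
    set B := (b : ℝ) ^ ∑ j ∈ Finset.range n, digLen b (a j)
    set C := (b : ℝ) ^ digLen b (a n)
    have hB : 0 < B := by positivity
    have hC : 0 < C := by positivity
    have : (a n : ℝ) / (B * C) ≤ 1 / B - 1 / (B * C) := by
      rw [le_sub_iff_add_le, ← add_div, div_le_div_iff₀ (by positivity) hB]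
      nlinarith
    linarith

lemma sum_concat_le_one {b : ℕ} (hb : 2 ≤ b) (a : ℕ → ℕ) (n : ℕ) :
    ∑ i ∈ Finset.range n, (a i : ℝ) / (b : ℝ) ^ (∑ j ∈ Finset.range (i + 1), digLen b (a j)) ≤
      1 :=
  (sum_concat_le hb a n).trans (sub_le_self _ (by positivity))

lemma summable_concat {b : ℕ} (hb : 2 ≤ b) (a : ℕ → ℕ) :
    Summable fun i => (a i : ℝ) / (b : ℝ) ^ (∑ j ∈ Finset.range (i + 1), digLen b (a j)) :=
  summable_of_sum_range_le (fun _ => by positivity) (sum_concat_le_one hb a)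

lemma concatVal_mem_Icc {b : ℕ} (hb : 2 ≤ b) (a : ℕ → ℕ) :
    concatVal b a ∈ Set.Icc (0 : ℝ) 1 :=
  ⟨tsum_nonneg fun _ => by positivity,
    Real.tsum_le_of_sum_range_le (fun _ => by positivity) (sum_concat_le_one hb a)⟩

lemma concatVal_eq {b : ℕ} (hb : 2 ≤ b) (a : ℕ → ℕ) :
    concatVal b a = (a 0 + concatVal b fun i => a (i + 1)) / (b : ℝ) ^ digLen b (a 0) := by
  rw [concatVal, (summable_concat hb a).tsum_eq_zero_add, concatVal, add_div, ← tsum_div_const]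
  refine congrArg₂ (· + ·) (by simp) (tsum_congr fun i => ?_)
  rw [Finset.sum_range_succ' _ (i + 1), pow_add, div_div]

/-- If a continued fraction starts with `l`, so does the sequence of its partial quotients. -/
lemma exists_concatVal_eq_digExtend {b : ℕ} (hb : 2 ≤ b) {l : List ℕ} (hl : ∀ h ∈ l, 0 < h)
    {t : ℝ} (ht : t ∈ Set.Ioo (0 : ℝ) 1) {a : ℕ → ℕ} (ha : ∀ i, 0 < a i)
    (hy : Tendsto (fun n => cfVal ((List.range n).map a)) atTop (𝓝 (cfExtend l t))) :
    ∃ v ∈ Set.Icc (0 : ℝ) 1, concatVal b a = digExtend b l v := by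
  induction l generalizing a with
  | nil => exact ⟨_, concatVal_mem_Icc hb a, rfl⟩
  | cons h l ih =>
    have hl' : ∀ k ∈ l, 0 < k := fun k hk => hl k (by simp [hk])
    obtain ⟨z, hz, hz01, hyz⟩ := exists_tail_cfVal ha hy
    have hc := cfExtend_mem_Ioo hl' ht
    simp only [cfExtend, one_div, inv_inj] at hyz
    have hh : h = a 0 := by
      have h1 : (h : ℝ) < a 0 + 1 := by linarith [hc.1, hz01.2]
      have h2 : (a 0 : ℝ) < h + 1 := by linarith [hc.2, hz01.1]
      norm_cast at h1 h2
      omega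
    subst hh
    rw [← add_left_cancel hyz] at hz
    obtain ⟨v, hv, he⟩ := ih hl' (fun i => ha (i + 1)) hz
    exact ⟨v, hv, by rw [concatVal_eq hb, he, digExtend]⟩

lemma digLen_base_pow {b : ℕ} (hb : 2 ≤ b) (k : ℕ) : digLen b (b ^ k) = k + 1 := by
  rw [digLen, Nat.length_digits b _ hb (by positivity), Nat.log_pow hb]

lemma digLen_base_pow_sub_one {b : ℕ} (hb : 2 ≤ b) (k : ℕ) :
    digLen b (b ^ (k + 1) - 1) = k + 1 := by
  have hk : 1 ≤ b ^ k := Nat.one_le_pow _ _ (by omega)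
  have h2 : 2 * b ^ k ≤ b ^ (k + 1) := by rw [pow_succ, mul_comm]; gcongr
  rw [digLen, Nat.length_digits b _ hb (by omega),
    Nat.log_eq_of_pow_le_of_lt_pow (m := k) (by omega) (by omega)]

/-! ### Nowhere density -/

/-- If `l` precedes arbitrarily large partial quotients `m k` of Trott numbers, and the digit
strings of the `m k` converge to the expansion of `c`, then `[0; l]` has the expansion given by
`l` followed by `c`. -/
lemma cfExtend_zero_eq_digExtend {b : ℕ} (hb : 2 ≤ b) {l : List ℕ} (hl : ∀ h ∈ l, 0 < h) {M : ℕ}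
    (H : ∀ m ≥ M, ∃ t v : ℝ, 0 ≤ t ∧ t ≤ 1 / m ∧ 0 ≤ v ∧ v ≤ 1 ∧
      cfExtend l t = digExtend b l ((m + v) / (b : ℝ) ^ digLen b m))
    {m : ℕ → ℕ} (hm : Tendsto m atTop atTop) {c : ℝ}
    (hc : Tendsto (fun k => (m k : ℝ) / (b : ℝ) ^ digLen b (m k)) atTop (𝓝 c)) :
    cfExtend l 0 = digExtend b l c := by
  choose! t v ht0 ht1 hv0 hv1 he using H
  have hmM : ∀ᶠ k in atTop, M ≤ m k := hm.eventually_ge_atTop M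
  have hmR : Tendsto (fun k => (m k : ℝ)) atTop atTop := tendsto_natCast_atTop_atTop.comp hm
  have ht : Tendsto (fun k => t (m k)) atTop (𝓝[≥] 0) := by
    refine tendsto_nhdsWithin_iff.2 ⟨?_, hmM.mono fun k hk => ht0 _ hk⟩
    refine tendsto_of_tendsto_of_tendsto_of_le_of_le' tendsto_const_nhds
      (tendsto_const_nhds.div_atTop hmR : Tendsto (fun k => (1 : ℝ) / m k) atTop (𝓝 0))
      (hmM.mono fun k hk => ht0 _ hk) (hmM.mono fun k hk => ht1 _ hk)
  have hlt : ∀ k, (m k : ℝ) ≤ (b : ℝ) ^ digLen b (m k) := fun k => by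
    exact_mod_cast (Nat.lt_base_pow_length_digits (m := m k) hb).le
  have hv : Tendsto (fun k => v (m k) / (b : ℝ) ^ digLen b (m k)) atTop (𝓝 0) := by
    refine tendsto_of_tendsto_of_tendsto_of_le_of_le' tendsto_const_nhds
      (tendsto_const_nhds.div_atTop (tendsto_atTop_mono hlt hmR) :
        Tendsto (fun k => (1 : ℝ) / (b : ℝ) ^ digLen b (m k)) atTop (𝓝 0))
      (hmM.mono fun k hk => ?_) (hmM.mono fun k hk => ?_)
    · have := hv0 _ hk
      positivity
    · have := hv1 _ hk
      gcongr
  have hd := ((continuous_digExtend b l).tendsto (c + 0)).comp (hc.add hv)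
  have hf := (continuousOn_cfExtend hl 0 Set.self_mem_Ici).tendsto.comp ht
  rw [add_zero] at hd
  refine tendsto_nhds_unique hf (hd.congr' (hmM.mono fun k hk => ?_))
  simp only [Function.comp_apply, he _ hk, add_div]

theorem isNowhereDense_trottSet {b : ℕ} (hb : 2 ≤ b) : IsNowhereDense (TrottSet b) := by
  rw [isNowhereDense_iff_disjoint, Set.disjoint_left]
  rintro x ⟨a, ha, hx, -⟩ hxU
  set U := interior (closure (TrottSet b))
  obtain ⟨n, hn⟩ := (hx.eventually (isOpen_interior.mem_nhds hxU)).exists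
  set l := (List.range n).map a
  have hl : ∀ h ∈ l, 0 < h := by
    simp only [l, List.mem_map]
    rintro h ⟨i, -, rfl⟩
    exact ha i
  change cfVal l ∈ U at hn
  rw [← cfExtend_zero] at hn
  have hnear : ∀ᶠ t in 𝓝[≥] (0 : ℝ), cfExtend l t ∈ U :=
    (continuousOn_cfExtend hl 0 Set.self_mem_Ici).eventually (isOpen_interior.mem_nhds hn)
  obtain ⟨δ, hδ, hsub⟩ := mem_nhdsGE_iff_exists_Ico_subset.1 hnear
  obtain ⟨M, hM⟩ := exists_nat_one_div_lt (Set.mem_Ioi.1 hδ)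
  have H : ∀ m ≥ M + 1, ∃ t v : ℝ, 0 ≤ t ∧ t ≤ 1 / m ∧ 0 ≤ v ∧ v ≤ 1 ∧
      cfExtend l t = digExtend b l ((m + v) / (b : ℝ) ^ digLen b m) := by
    intro m hm
    have hmpos : (0 : ℝ) < m := by exact_mod_cast (by omega : 0 < m)
    have hmM : (M : ℝ) + 1 ≤ m := by exact_mod_cast hm
    have hl' : ∀ h ∈ l ++ [m], 0 < h := by
      simp only [List.mem_append, List.mem_singleton]
      rintro h (h1 | rfl)
      · exact hl h h1
      · omega
    have htle : ∀ s ∈ Set.Ioo (0 : ℝ) 1, 1 / ((m : ℝ) + s) ≤ 1 / m := fun s hs =>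
      one_div_le_one_div_of_le hmpos (by linarith [hs.1])
    have himg := (isOpen_image_cfExtend (l ++ [m]) (isOpen_Ioo (a := (0 : ℝ)) (b := 1))
      fun s hs => hs.1).1
    have hmem : cfExtend (l ++ [m]) (1 / 2) ∈ closure (TrottSet b) := by
      rw [cfExtend_append_singleton]
      refine interior_subset (hsub ⟨by positivity, ?_⟩)
      calc 1 / ((m : ℝ) + 1 / 2) ≤ 1 / m := htle _ (by norm_num)
        _ ≤ 1 / (M + 1) := one_div_le_one_div_of_le (by positivity) hmM
        _ < δ := hM
    obtain ⟨y, ⟨s, hs, hsy⟩, a', ha', hy, hya⟩ := mem_closure_iff.1 hmem _ himg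
      ⟨1 / 2, by norm_num, rfl⟩
    rw [← hsy] at hy
    obtain ⟨v, hv, he⟩ := exists_concatVal_eq_digExtend hb hl' hs ha' hy
    refine ⟨1 / (m + s), v, by have := hs.1; positivity, htle s hs, hv.1, hv.2, ?_⟩
    rw [← cfExtend_append_singleton, ← digExtend_append_singleton, ← he, hsy]
    exact hya
  have hb1 : (1 : ℝ) < b := by exact_mod_cast hb
  have hpow : Tendsto (fun k => b ^ k) atTop atTop := tendsto_pow_atTop_atTop_of_one_lt hb
  have hpow' : Tendsto (fun k => b ^ (k + 1) - 1) atTop atTop :=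
    (tendsto_sub_atTop_nat 1).comp (hpow.comp (tendsto_add_atTop_nat 1))
  have e1 : cfExtend l 0 = digExtend b l (1 / b) := by
    refine cfExtend_zero_eq_digExtend hb hl H hpow (tendsto_const_nhds.congr fun k => ?_)
    rw [digLen_base_pow hb, pow_succ]
    push_cast
    field_simp
  have e2 : cfExtend l 0 = digExtend b l 1 := by
    refine cfExtend_zero_eq_digExtend hb hl H hpow' ?_
    have hlim : Tendsto (fun k : ℕ => 1 - 1 / (b : ℝ) ^ (k + 1)) atTop (𝓝 (1 - 0)) :=
      tendsto_const_nhds.sub (tendsto_const_nhds.div_atTop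
        ((tendsto_pow_atTop_atTop_of_one_lt hb1).comp (tendsto_add_atTop_nat 1)))
    rw [sub_zero] at hlim
    refine hlim.congr fun k => ?_
    rw [digLen_base_pow_sub_one hb, Nat.cast_sub (Nat.one_le_pow _ _ (by omega))]
    push_cast
    field_simp
  have h1 := digExtend_injective hb l (e1.symm.trans e2)
  rw [div_eq_one_iff_eq (by positivity)] at h1
  linarith

/-- A positive lower bound on a Trott number bounds its base. -/
lemma IsTrott.pos_and_base_le {b : ℕ} (hb : 2 ≤ b) {x : ℝ} (h : IsTrott b x) :
    0 < x ∧ (b : ℝ) ≤ (1 / x + 1) / x := by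
  obtain ⟨a, ha, hx, hxa⟩ := h
  obtain ⟨z, -, hz, hxz⟩ := exists_tail_cfVal ha hx
  have hv := concatVal_mem_Icc hb fun i => a (i + 1)
  have hxv : x = (a 0 + concatVal b fun i => a (i + 1)) / (b : ℝ) ^ digLen b (a 0) :=
    hxa.trans (concatVal_eq hb a)
  set v := concatVal b fun i => a (i + 1)
  have ha0 : (0 : ℝ) < a 0 := by exact_mod_cast ha 0
  have hbpos : (0 : ℝ) < b := by positivity
  have hz0 := hz.1
  have hxpos : 0 < x := by rw [hxz]; positivity
  have hax : (a 0 : ℝ) < 1 / x := by rw [hxz, one_div_one_div]; linarith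
  have hbx : 1 / x ≤ b := by
    have hle : (b : ℝ) ^ digLen b (a 0) ≤ b * a 0 := by
      exact_mod_cast Nat.base_pow_length_digits_le b (a 0) hb (ha 0).ne'
    have hC : (0 : ℝ) < (b : ℝ) ^ digLen b (a 0) := by positivity
    rw [div_le_iff₀ hxpos, hxv, ← mul_div_assoc, le_div_iff₀ hC]
    nlinarith [hv.1]
  have hab : a 0 < b := by exact_mod_cast hax.trans_le hbx
  have hlen : digLen b (a 0) = 1 := by
    rw [digLen, Nat.digits_of_lt b _ (ha 0).ne' hab, List.length_singleton]
  refine ⟨hxpos, ?_⟩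
  rw [hlen, pow_one, eq_div_iff hbpos.ne'] at hxv
  rw [le_div_iff₀ hxpos]
  linarith [hv.2]

lemma IsNowhereDense.biUnion_finset {X ι : Type*} [TopologicalSpace X] (s : Finset ι)
    {f : ι → Set X} (hf : ∀ i ∈ s, IsNowhereDense (f i)) : IsNowhereDense (⋃ i ∈ s, f i) := by
  classical
  induction s using Finset.induction_on with
  | empty => simp
  | insert i s _ ih =>
    rw [Finset.set_biUnion_insert, IsNowhereDense, closure_union,
      interior_union_isClosed_of_interior_empty isClosed_closure
        (ih fun j hj => hf j (Finset.mem_insert_of_mem hj))]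
    exact hf i (Finset.mem_insert_self i s)

/-- The set `T = ⋃_{b ≥ 2} T_b` of numbers Trott in some base is nowhere dense in `ℝ`. -/
theorem trott_union_isNowhereDense :
    IsNowhereDense {x : ℝ | ∃ b : ℕ, 2 ≤ b ∧ IsTrott b x} := by
  rw [isNowhereDense_iff_disjoint, Set.disjoint_left]
  rintro x ⟨b, hb, hx⟩ hxU
  set T := {x : ℝ | ∃ b : ℕ, 2 ≤ b ∧ IsTrott b x}
  have hxpos := (hx.pos_and_base_le hb).1
  obtain ⟨N, hN⟩ := exists_nat_ge ((1 / (x / 2) + 1) / (x / 2))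
  have hsub : T ∩ Set.Ioi (x / 2) ⊆ ⋃ c ∈ Finset.Icc 2 N, TrottSet c := by
    rintro y ⟨⟨c, hc, hy⟩, hxy⟩
    have hxy : x / 2 < y := hxy
    have hle : (c : ℝ) ≤ N := (hy.pos_and_base_le hc).2.trans (le_trans (by gcongr) hN)
    exact Set.mem_biUnion (Finset.mem_coe.2 (Finset.mem_Icc.2 ⟨hc, by exact_mod_cast hle⟩)) hy
  have hnd : IsNowhereDense (T ∩ Set.Ioi (x / 2)) :=
    (IsNowhereDense.biUnion_finset _ fun c hc =>
      isNowhereDense_trottSet (Finset.mem_Icc.1 hc).1).mono hsub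
  have hmem : x ∈ interior (closure (T ∩ Set.Ioi (x / 2))) := by
    refine interior_maximal (t := interior (closure T) ∩ Set.Ioi (x / 2)) ?_
      (isOpen_interior.inter isOpen_Ioi) ⟨hxU, by simpa using hxpos⟩
    exact (Set.inter_subset_inter_left _ interior_subset).trans isOpen_Ioi.closure_inter
  rw [hnd] at hmem
  exact hmem
end
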